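/- Let ξ and η be real numbers with η > 0, and let L be the Lindblad generator on M₂ with parameters ξ, η, ν = 0, ζ = 0 and D = [[0,0],[1,0]]. For a density matrix ρ set ρ_t = e^{tL}(ρ). Then for all t ≥ 0: u₁(ρ_t) = e^{−ηt/2}(u₁(ρ)cos(2ξt) − u₂(ρ)sin(2ξt)) and u₂(ρ_t) = e^{−ηt/2}(u₁(ρ)sin(2ξt) + u₂(ρ)cos(2ξt)); moreover, if ρ ≠ ½(I − σ₃), then lim_{t→∞} (1 − ‖u(ρ_t)‖)^{1/t} = e^{−η}, where ‖u(ρ_t)‖ = (u₁(ρ_t)² + u₂(ρ_t)² + u₃(ρ_t)²)^{1/2} (equivalently, the least eigenvalue ½(1 − ‖u(ρ_t)‖) of ρ_t decays at exponential rate e^{−η}). -/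

import Mathlib

open scoped ComplexOrder
open Filter Topology Matrix

noncomputable section

abbrev M2 := Matrix (Fin 2) (Fin 2) ℂ

def σ₁ : M2 := !![0, 1; 1, 0]
def σ₂ : M2 := !![0, -Complex.I; Complex.I, 0]
def σ₃ : M2 := !![1, 0; 0, -1]

/-- The matrix `D = [[0,0],[1,0]]`. -/
def Dm : M2 := !![0, 0; 1, 0]

def u₁ (ρ : M2) : ℂ := (ρ * σ₁).trace
def u₂ (ρ : M2) : ℂ := (ρ * σ₂).trace
def u₃ (ρ : M2) : ℂ := (ρ * σ₃).trace

def IsDensity (ρ : M2) : Prop := ρ.PosSemidef ∧ ρ.trace = 1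

/-- The Lindblad generator with parameters `ξ, η, ν, ζ` and `D = [[0,0],[1,0]]`. -/
def IsLindblad (ξ η ν : ℝ) (ζ : ℂ) (L : M2 →ₗ[ℂ] M2) : Prop :=
  ∀ ρ : M2, L ρ =
    (Complex.I * (ξ : ℂ)) • ((Dm * Dmᴴ - Dmᴴ * Dm) * ρ - ρ * (Dm * Dmᴴ - Dmᴴ * Dm))
    - (((ν + η) / 2 : ℝ) : ℂ) • (Dmᴴ * Dm * ρ - 2 * (Dm * ρ * Dmᴴ) + ρ * (Dmᴴ * Dm))
    - ((ν / 2 : ℝ) : ℂ) • (Dm * Dmᴴ * ρ - 2 * (Dmᴴ * ρ * Dm) + ρ * (Dm * Dmᴴ))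
    + (starRingEnd ℂ ζ) • (Dm * ρ * Dm) + ζ • (Dmᴴ * ρ * Dmᴴ)

/-- `S t = e^{tL}`, characterized as the solution of the associated linear ODE. -/
def IsExpSemigroup (L : M2 →ₗ[ℂ] M2) (S : ℝ → M2 →ₗ[ℂ] M2) : Prop :=
  S 0 = LinearMap.id ∧
  ∀ (ρ : M2) (i j : Fin 2) (t : ℝ),
    HasDerivAt (fun s => S s ρ i j) ((L (S t ρ)) i j) t
/-- `‖u(ρ)‖`, the euclidean norm of the Bloch vector of `ρ`. -/
def normu (ρ : M2) : ℝ := Real.sqrt ((u₁ ρ).re ^ 2 + (u₂ ρ).re ^ 2 + (u₃ ρ).re ^ 2)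

lemma ode_aux (f : ℝ → ℂ) (c : ℂ) (h : ∀ t, HasDerivAt f (c * f t) t) (t : ℝ) :
    f t = f 0 * Complex.exp (c * t) := by
  have key : ∀ s : ℝ, HasDerivAt (fun s : ℝ => f s * Complex.exp (-(c * s))) 0 s := by
    intro s
    have h1 : HasDerivAt (fun s : ℝ => Complex.exp (-(c * s)))
        (Complex.exp (-(c * s)) * (-(c * 1))) s := by
      have h0 : HasDerivAt (fun s : ℝ => (s : ℂ)) 1 s := Complex.ofRealCLM.hasDerivAt
      exact ((h0.const_mul c).neg).cexp
    have h2 := (h s).mul h1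
    refine h2.congr_deriv ?_
    ring
  have hc := is_const_of_deriv_eq_zero (fun s => (key s).differentiableAt)
    (fun s => (key s).deriv) t 0
  simp only [Complex.ofReal_zero, mul_zero, neg_zero, Complex.exp_zero, mul_one] at hc
  rw [← hc, mul_assoc, ← Complex.exp_add]
  simp

lemma lim_aux (η a m : ℝ) (hη : 0 < η) (ha : 0 < a) (hm : m ≤ 4 * a * (1 - a))
    (hm0 : 0 ≤ m) :
    Tendsto (fun t : ℝ => (1 - Real.sqrt (Real.exp (-η * t) * m
      + (2 * a * Real.exp (-η * t) - 1) ^ 2)) ^ (1 / t)) atTop (𝓝 (Real.exp (-η))) := by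
  have hE : Tendsto (fun t : ℝ => Real.exp (-η * t)) atTop (𝓝 0) := by
    apply Real.tendsto_exp_atBot.comp
    exact tendsto_id.const_mul_atTop_of_neg (by linarith)
  have hN : Tendsto (fun t : ℝ => Real.sqrt (Real.exp (-η * t) * m
      + (2 * a * Real.exp (-η * t) - 1) ^ 2)) atTop (𝓝 1) := by
    have := ((hE.mul_const m).add (((hE.const_mul (2*a)).sub_const 1).pow 2)).sqrt
    simpa using this
  set N : ℝ → ℝ := fun t : ℝ => Real.sqrt (Real.exp (-η * t) * m
      + (2 * a * Real.exp (-η * t) - 1) ^ 2) with hNdef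
  have hN0 : ∀ t, 0 ≤ N t := fun t => Real.sqrt_nonneg _
  let g : ℝ → ℝ := fun t => (4 * a - m - 4 * a ^ 2 * Real.exp (-η * t)) / (1 + N t)
  have hg : Tendsto g atTop (𝓝 ((4 * a - m) / 2)) := by
    have := ((hE.const_mul (4 * a ^ 2)).const_sub (4 * a - m)).div (hN.const_add 1) (by norm_num)
    have e : (4 * a - m) / 2 = (4 * a - m - 4 * a ^ 2 * 0) / (1 + 1) := by ring
    rw [e]
    exact this
  have hpos : 0 < (4 * a - m) / 2 := by nlinarith
  have hfac : ∀ t, 1 - N t = Real.exp (-η * t) * g t := by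
    intro t
    have h1 : N t ^ 2 = Real.exp (-η * t) * m + (2 * a * Real.exp (-η * t) - 1) ^ 2 :=
      Real.sq_sqrt (by positivity)
    have h2 : 1 + N t ≠ 0 := by linarith [hN0 t]
    simp only [g]
    field_simp
    have e : Real.exp (-(η * t)) = Real.exp (-η * t) := by congr 1; ring
    try rw [e]
    linear_combination -h1
  have hinv : Tendsto (fun t : ℝ => 1 / t) atTop (𝓝 0) := by
    simpa using tendsto_inv_atTop_zero (𝕜 := ℝ)
  have hp := (hg.rpow hinv (Or.inl hpos.ne')).const_mul (Real.exp (-η))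
  rw [Real.rpow_zero, mul_one] at hp
  refine hp.congr' ?_
  filter_upwards [eventually_gt_atTop 0, hg.eventually (lt_mem_nhds hpos)] with t ht hgt
  change _ = (1 - N t) ^ (1 / t)
  rw [hfac t, Real.mul_rpow (Real.exp_pos _).le hgt.le, ← Real.exp_mul]
  congr 2
  field_simp

theorem statement19 (ξ η : ℝ) (hη : 0 < η)
    (L : M2 →ₗ[ℂ] M2) (hL : IsLindblad ξ η 0 0 L)
    (S : ℝ → M2 →ₗ[ℂ] M2) (hS : IsExpSemigroup L S) :
    ∀ ρ : M2, IsDensity ρ →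
      (∀ t : ℝ, 0 ≤ t →
        u₁ (S t ρ) = (Real.exp (-η * t / 2) : ℂ) *
            (u₁ ρ * (Real.cos (2 * ξ * t) : ℂ) - u₂ ρ * (Real.sin (2 * ξ * t) : ℂ)) ∧
        u₂ (S t ρ) = (Real.exp (-η * t / 2) : ℂ) *
            (u₁ ρ * (Real.sin (2 * ξ * t) : ℂ) + u₂ ρ * (Real.cos (2 * ξ * t) : ℂ))) ∧
      (ρ ≠ (1 / 2 : ℂ) • ((1 : M2) - σ₃) →
        Tendsto (fun t => (1 - normu (S t ρ)) ^ (1 / t)) atTop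
          (𝓝 (Real.exp (-η)))) := by
  intro ρ hρ
  obtain ⟨hpsd, htr⟩ := hρ
  obtain ⟨hS0, hSd⟩ := hS
  have hDH : Dmᴴ = !![0, 1; 0, 0] := by
    ext i j
    fin_cases i <;> fin_cases j <;> simp [Dm]
  have hL00 : ∀ A : M2, L A 0 0 = (-η : ℂ) * A 0 0 := by
    intro A
    rw [hL A, hDH]
    simp [Dm, Matrix.mul_apply, Matrix.vecMul, dotProduct, Fin.sum_univ_two, Matrix.ofNat_apply]
    ring
  have hL01 : ∀ A : M2, L A 0 1 = (-η / 2 - 2 * ξ * Complex.I : ℂ) * A 0 1 := by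
    intro A
    rw [hL A, hDH]
    simp [Dm, Matrix.mul_apply, Matrix.vecMul, dotProduct, Fin.sum_univ_two, Matrix.ofNat_apply]
    ring
  have hL10 : ∀ A : M2, L A 1 0 = (-η / 2 + 2 * ξ * Complex.I : ℂ) * A 1 0 := by
    intro A
    rw [hL A, hDH]
    simp [Dm, Matrix.mul_apply, Matrix.vecMul, dotProduct, Fin.sum_univ_two, Matrix.ofNat_apply]
    ring
  have hL11 : ∀ A : M2, L A 0 0 + L A 1 1 = 0 := by
    intro A
    rw [hL A, hDH]
    simp [Dm, Matrix.mul_apply, Matrix.vecMul, dotProduct, Fin.sum_univ_two, Matrix.ofNat_apply]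
    ring
  have s00 : ∀ t : ℝ, S t ρ 0 0 = ρ 0 0 * Complex.exp ((-η : ℂ) * t) := by
    intro t
    have := ode_aux (fun s => S s ρ 0 0) (-η : ℂ) (fun t => by rw [← hL00]; exact hSd ρ 0 0 t) t
    simpa [hS0] using this
  have s01 : ∀ t : ℝ, S t ρ 0 1 =
      ρ 0 1 * Complex.exp ((-η / 2 - 2 * ξ * Complex.I : ℂ) * t) := by
    intro t
    have := ode_aux (fun s => S s ρ 0 1) (-η / 2 - 2 * ξ * Complex.I : ℂ)
      (fun t => by rw [← hL01]; exact hSd ρ 0 1 t) t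
    simpa [hS0] using this
  have s10 : ∀ t : ℝ, S t ρ 1 0 =
      ρ 1 0 * Complex.exp ((-η / 2 + 2 * ξ * Complex.I : ℂ) * t) := by
    intro t
    have := ode_aux (fun s => S s ρ 1 0) (-η / 2 + 2 * ξ * Complex.I : ℂ)
      (fun t => by rw [← hL10]; exact hSd ρ 1 0 t) t
    simpa [hS0] using this
  have htr' : ρ 0 0 + ρ 1 1 = 1 := by simpa [Matrix.trace, Fin.sum_univ_two] using htr
  have s11 : ∀ t : ℝ, S t ρ 0 0 + S t ρ 1 1 = 1 := by
    intro t
    have := ode_aux (fun s => S s ρ 0 0 + S s ρ 1 1) 0 (fun t => by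
      rw [zero_mul, ← hL11 (S t ρ)]; exact (hSd ρ 0 0 t).add (hSd ρ 1 1 t)) t
    simpa [hS0, htr'] using this
  have e1 : ∀ A : M2, u₁ A = A 0 1 + A 1 0 := by
    intro A
    simp [u₁, σ₁, Matrix.trace, Matrix.mul_apply, Fin.sum_univ_two]
  have e2 : ∀ A : M2, u₂ A = Complex.I * (A 0 1 - A 1 0) := by
    intro A
    simp [u₂, σ₂, Matrix.trace, Matrix.mul_apply, Fin.sum_univ_two]
    ring
  have e3 : ∀ A : M2, u₃ A = A 0 0 - A 1 1 := by
    intro A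
    simp [u₃, σ₃, Matrix.trace, Matrix.mul_apply, Fin.sum_univ_two]
    try ring
  have x1 : ∀ t : ℝ, Complex.exp ((-η / 2 - 2 * ξ * Complex.I : ℂ) * t) =
      (Real.exp (-η * t / 2) : ℂ) *
        ((Real.cos (2 * ξ * t) : ℂ) - (Real.sin (2 * ξ * t) : ℂ) * Complex.I) := by
    intro t
    have : (-η / 2 - 2 * ξ * Complex.I : ℂ) * t =
      ((-η * t / 2 : ℝ) : ℂ) + ((-(2 * ξ * t) : ℝ) : ℂ) * Complex.I := by push_cast; ring
    rw [this, Complex.exp_add, Complex.exp_mul_I, ← Complex.ofReal_cos, ← Complex.ofReal_sin,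
      Real.cos_neg, Real.sin_neg, Complex.ofReal_exp]
    push_cast
    ring
  have x2 : ∀ t : ℝ, Complex.exp ((-η / 2 + 2 * ξ * Complex.I : ℂ) * t) =
      (Real.exp (-η * t / 2) : ℂ) *
        ((Real.cos (2 * ξ * t) : ℂ) + (Real.sin (2 * ξ * t) : ℂ) * Complex.I) := by
    intro t
    have : (-η / 2 + 2 * ξ * Complex.I : ℂ) * t =
      ((-η * t / 2 : ℝ) : ℂ) + ((2 * ξ * t : ℝ) : ℂ) * Complex.I := by push_cast; ring
    rw [this, Complex.exp_add, Complex.exp_mul_I, ← Complex.ofReal_cos, ← Complex.ofReal_sin,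
      Complex.ofReal_exp]
  have part1 : ∀ t : ℝ, 
        u₁ (S t ρ) = (Real.exp (-η * t / 2) : ℂ) *
            (u₁ ρ * (Real.cos (2 * ξ * t) : ℂ) - u₂ ρ * (Real.sin (2 * ξ * t) : ℂ)) ∧
        u₂ (S t ρ) = (Real.exp (-η * t / 2) : ℂ) *
            (u₁ ρ * (Real.sin (2 * ξ * t) : ℂ) + u₂ ρ * (Real.cos (2 * ξ * t) : ℂ)) := by
    intro t
    rw [e1, e2, e1, e2, s01, s10, x1, x2]
    constructor
    · ring
    · linear_combination (-(Real.exp (-η * t / 2) : ℂ) * (Real.sin (2 * ξ * t) : ℂ) *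
        (ρ 0 1 + ρ 1 0)) * Complex.I_sq
  refine ⟨fun t _ => part1 t, fun hne => ?_⟩
  have hh : ρ 1 0 = star (ρ 0 1) := (hpsd.isHermitian.apply 1 0).symm
  have h00 := hpsd.diag_nonneg (i := 0)
  have hdet := hpsd.det_nonneg
  rw [Matrix.det_fin_two] at hdet
  rw [Complex.le_def] at h00 hdet
  have h11 : ρ 1 1 = 1 - ρ 0 0 := by linear_combination htr'
  obtain ⟨h00r, h00i⟩ := h00
  have hd := hdet.1
  rw [hh, h11] at hd
  simp at hd h00r h00i
  have hm : (u₁ ρ).re ^ 2 + (u₂ ρ).re ^ 2 ≤ 4 * (ρ 0 0).re * (1 - (ρ 0 0).re) := by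
    rw [e1, e2, hh]
    simp [← h00i] at hd ⊢
    nlinarith
  have ha : 0 < (ρ 0 0).re := by
    rcases h00r.lt_or_eq with h | h
    · exact h
    · exfalso
      apply hne
      have hz : ρ 0 0 = 0 := Complex.ext h.symm h00i.symm
      have hb : ρ 0 1 = 0 := by
        rw [hz] at hd
        simp at hd
        apply Complex.ext <;> simp <;> nlinarith
      ext i j
      fin_cases i <;> fin_cases j <;> simp [σ₃, hz, hb, hh, h11]
      norm_num
  have hnorm : ∀ t, normu (S t ρ) = Real.sqrt (Real.exp (-η * t) *
      ((u₁ ρ).re ^ 2 + (u₂ ρ).re ^ 2) + (2 * (ρ 0 0).re * Real.exp (-η * t) - 1) ^ 2) := by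
    intro t
    have r1 := congrArg Complex.re (part1 t).1
    have r2 := congrArg Complex.re (part1 t).2
    rw [Complex.re_ofReal_mul, Complex.sub_re, Complex.re_mul_ofReal, Complex.re_mul_ofReal] at r1
    rw [Complex.re_ofReal_mul, Complex.add_re, Complex.re_mul_ofReal, Complex.re_mul_ofReal] at r2
    have r3 : (u₃ (S t ρ)).re = 2 * (ρ 0 0).re * Real.exp (-η * t) - 1 := by
      have h1 : u₃ (S t ρ) = 2 * (ρ 0 0 * ((Real.exp (-η * t) : ℝ) : ℂ)) - 1 := by
        rw [e3]
        push_cast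
        rw [← s00]
        linear_combination -s11 t
      rw [h1, Complex.sub_re, ← Complex.ofReal_ofNat, Complex.re_ofReal_mul,
        Complex.re_mul_ofReal, Complex.one_re]
      ring
    have hsq : Real.exp (-η * t) = Real.exp (-η * t / 2) ^ 2 := by
      rw [← Real.exp_nat_mul]; congr 1; push_cast; ring
    unfold normu
    rw [r1, r2, r3]
    congr 2
    rw [hsq]
    linear_combination (Real.exp (-η * t / 2) ^ 2 * ((u₁ ρ).re ^ 2 + (u₂ ρ).re ^ 2)) *
      Real.sin_sq_add_cos_sq (2 * ξ * t)
  simp only [hnorm]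
  exact lim_aux η _ _ hη ha hm (by positivity)
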